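/- arXiv:2104.12261 — 7 statements merged into one kernel-verified Lean document; each statement's English description precedes it below -/
import Mathlib

section
/- Let ω > 0 and let σ ∈ {+1, −1} be such that 1 + 38ω⁴ − 23ω⁸ ≥ 0 and 1 + 8ω² − 5ω⁴ + σ·√(1 + 38ω⁴ − 23ω⁸) ≥ 0. Then ζ := (1/(4ω))·√(1 + 8ω² − 5ω⁴ + σ·√(1 + 38ω⁴ − 23ω⁸)) satisfies P(ζ,ω) = 0. -/
/-- Inflection-point polynomial
`P(ζ,ω) := 3ω⁶ + 5(2ζ²−1)ω⁴ + (16ζ⁴−16ζ²+1)ω² + 1 − 2ζ²`. -/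
noncomputable def oscP (ζ ω : ℝ) : ℝ :=
  3*ω^6 + 5*(2*ζ^2 - 1)*ω^4 + (16*ζ^4 - 16*ζ^2 + 1)*ω^2 + 1 - 2*ζ^2

/-- if `ω > 0`, `σ = ±1`, `1 + 38ω⁴ − 23ω⁸ ≥ 0`, and
`1 + 8ω² − 5ω⁴ + σ√(1 + 38ω⁴ − 23ω⁸) ≥ 0`, then
`ζ := (1/(4ω))√(1 + 8ω² − 5ω⁴ + σ√(1 + 38ω⁴ − 23ω⁸))` satisfies `P(ζ,ω) = 0`. -/
theorem stmt2 (ω σ : ℝ) (hω : 0 < ω) (hσ : σ = 1 ∨ σ = -1)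
    (h1 : 0 ≤ 1 + 38*ω^4 - 23*ω^8)
    (h2 : 0 ≤ 1 + 8*ω^2 - 5*ω^4 + σ * Real.sqrt (1 + 38*ω^4 - 23*ω^8)) :
    oscP ((1/(4*ω)) *
      Real.sqrt (1 + 8*ω^2 - 5*ω^4 + σ * Real.sqrt (1 + 38*ω^4 - 23*ω^8))) ω = 0 := by
  have hr := Real.sq_sqrt h1
  have hσ2 : σ ^ 2 = 1 := by rcases hσ with rfl | rfl <;> norm_num
  set r := Real.sqrt (1 + 38*ω^4 - 23*ω^8)
  have hs := Real.sq_sqrt h2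
  set s := Real.sqrt (1 + 8*ω^2 - 5*ω^4 + σ * r)
  have hζ : 16 * ω^2 * (1/(4*ω) * s)^2 = 1 + 8*ω^2 - 5*ω^4 + σ * r := by
    rw [← hs]
    field_simp
    norm_num
  generalize 1/(4*ω) * s = ζ at hζ ⊢
  have hP : 16 * ω^2 * oscP ζ ω = 0 := by
    unfold oscP
    linear_combination (16*ω^2*ζ^2 - (1 + 8*ω^2 - 5*ω^4) + σ*r) * hζ + σ^2 * hr +
      (1 + 38*ω^4 - 23*ω^8) * hσ2
  exact (mul_eq_zero.mp hP).resolve_left (by positivity)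
end

section
/- Let ζ > 0, ω₁, ω₂ > 0, ε ∈ ℝ, and A₁,B₁,C₁,A₂,B₂,C₂ ∈ ℝ with C₁ > 0 and C₂ > 0, satisfying the constraints: C₁² = A₁² + B₁², C₂² = A₂² + B₂², ω₁ − ω₂ = ε, (1−ω₁²)A₁ + 2ζω₁B₁ = 1, (1−ω₁²)B₁ = 2ζω₁A₁, (1−ω₂²)A₂ + 2ζω₂B₂ = 1, (1−ω₂²)B₂ = 2ζω₂A₂. Then there exist λ₁,…,λ₇ ∈ ℝ satisfying the adjoint conditions 1 + 2C₁λ₁ = 0, −1 + 2C₂λ₂ = 0, −2A₁λ₁ + (1−ω₁²)λ₄ − 2ζω₁λ₅ = 0, −2A₂λ₂ + (1−ω₂²)λ₆ − 2ζω₂λ₇ = 0, −2B₁λ₁ + 2ζω₁λ₄ + (1−ω₁²)λ₅ = 0, −2B₂λ₂ + 2ζω₂λ₆ + (1−ω₂²)λ₇ = 0, λ₃ + 2(ζB₁−ω₁A₁)λ₄ − 2(ζA₁+ω₁B₁)λ₅ = 0, and −λ₃ + 2(ζB₂−ω₂A₂)λ₆ − 2(ζA₂+ω₂B₂)λ₇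 = 0 if and only if ω₁(1−2ζ²−ω₁²)/D(ζ,ω₁)^{3/2} = ω₂(1−2ζ²−ω₂²)/D(ζ,ω₂)^{3/2}. In that case the multipliers are unique and given by λ₁ = −√D(ζ,ω₁)/2, λ₂ = √D(ζ,ω₂)/2, λ₃ = −2ω₁(1−2ζ²−ω₁²)/D(ζ,ω₁)^{3/2}, λ₄ = −1/√D(ζ,ω₁), λ₅ = 0, λ₆ = 1/√D(ζ,ω₂), λ₇ = 0. -/
/-- `D(ζ,ω) := (1−ω²)² + 4ζ²ω²`. -/
noncomputable def oscD (ζ ω : ℝ) : ℝ := (1 - ω^2)^2 + 4*ζ^2*ω^2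

/-- The adjoint (Lagrange-multiplier stationarity) conditions for optimizing `C₁ − C₂`
with respect to `ω₁` subject to the steady-state constraints. -/
def adjointConds (ζ ω₁ ω₂ A₁ B₁ C₁ A₂ B₂ C₂ l₁ l₂ l₃ l₄ l₅ l₆ l₇ : ℝ) : Prop :=
  1 + 2*C₁*l₁ = 0 ∧ -1 + 2*C₂*l₂ = 0 ∧
  -2*A₁*l₁ + (1 - ω₁^2)*l₄ - 2*ζ*ω₁*l₅ = 0 ∧
  -2*A₂*l₂ + (1 - ω₂^2)*l₆ - 2*ζ*ω₂*l₇ = 0 ∧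
  -2*B₁*l₁ + 2*ζ*ω₁*l₄ + (1 - ω₁^2)*l₅ = 0 ∧
  -2*B₂*l₂ + 2*ζ*ω₂*l₆ + (1 - ω₂^2)*l₇ = 0 ∧
  l₃ + 2*(ζ*B₁ - ω₁*A₁)*l₄ - 2*(ζ*A₁ + ω₁*B₁)*l₅ = 0 ∧
  -l₃ + 2*(ζ*B₂ - ω₂*A₂)*l₆ - 2*(ζ*A₂ + ω₂*B₂)*l₇ = 0

theorem oscD_pos {ζ ω : ℝ} (hζ : 0 < ζ) (hω : 0 < ω) : 0 < oscD ζ ω := by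
  unfold oscD
  positivity

theorem oscD_rpow_three_halves {ζ ω : ℝ} (hD : 0 < oscD ζ ω) :
    (oscD ζ ω) ^ ((3:ℝ)/2) = Real.sqrt (oscD ζ ω) ^ 3 := by
  rw [Real.sqrt_eq_rpow, ← Real.rpow_natCast, ← Real.rpow_mul hD.le]
  norm_num

/-- The steady-state constraints determine the amplitudes `A`, `B` and `C`. -/
theorem steadyState_eq {ζ ω A B C : ℝ} (hζ : 0 < ζ) (hω : 0 < ω) (hC : 0 < C)
    (hABC : C^2 = A^2 + B^2) (hcos : (1 - ω^2)*A + 2*ζ*ω*B = 1)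
    (hsin : (1 - ω^2)*B = 2*ζ*ω*A) :
    A = (1 - ω^2) / Real.sqrt (oscD ζ ω) ^ 2 ∧ B = 2*ζ*ω / Real.sqrt (oscD ζ ω) ^ 2 ∧
      C = 1 / Real.sqrt (oscD ζ ω) := by
  have hD := oscD_pos hζ hω
  have hs := Real.sqrt_pos.2 hD
  have hA : A * oscD ζ ω = 1 - ω^2 := by
    unfold oscD
    linear_combination (1 - ω^2) * hcos - 2*ζ*ω * hsin
  have hB : B * oscD ζ ω = 2*ζ*ω := by
    unfold oscD
    linear_combination 2*ζ*ω * hcos + (1 - ω^2) * hsin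
  have hCD : C^2 * oscD ζ ω = 1 := by
    linear_combination oscD ζ ω * hABC + A * hA + B * hB + hcos
  rw [Real.sq_sqrt hD.le]
  refine ⟨(eq_div_iff hD.ne').2 hA, (eq_div_iff hD.ne').2 hB, (eq_div_iff hs.ne').2 ?_⟩
  rw [← Real.sq_sqrt hD.le, ← mul_pow] at hCD
  exact (pow_eq_one_iff_of_nonneg (by positivity) two_ne_zero).1 hCD

/-- The adjoint conditions of one oscillator, entering the objective with weight `σ` and coupled
to the other one through `μ`, have exactly one solution. -/
theorem oscillator_adjoint_iff {ζ ω A B C : ℝ} (hζ : 0 < ζ) (hω : 0 < ω) (hC : 0 < C)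
    (hABC : C^2 = A^2 + B^2) (hcos : (1 - ω^2)*A + 2*ζ*ω*B = 1)
    (hsin : (1 - ω^2)*B = 2*ζ*ω*A) (σ l m n μ : ℝ) :
    (σ + 2*C*l = 0 ∧ -2*A*l + (1 - ω^2)*m - 2*ζ*ω*n = 0 ∧
      -2*B*l + 2*ζ*ω*m + (1 - ω^2)*n = 0 ∧
      μ + 2*(ζ*B - ω*A)*m - 2*(ζ*A + ω*B)*n = 0) ↔
    (l = -σ * Real.sqrt (oscD ζ ω) / 2 ∧ m = -σ / Real.sqrt (oscD ζ ω) ∧ n = 0 ∧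
      μ = -2*σ*(ω*(1 - 2*ζ^2 - ω^2) / (oscD ζ ω) ^ ((3:ℝ)/2))) := by
  have hD := oscD_pos hζ hω
  obtain ⟨hA, hB, hC'⟩ := steadyState_eq hζ hω hC hABC hcos hsin
  rw [oscD_rpow_three_halves hD]
  have hs := Real.sqrt_pos.2 hD
  have hsq : Real.sqrt (oscD ζ ω) ^ 2 = (1 - ω^2)^2 + 4*ζ^2*ω^2 := Real.sq_sqrt hD.le
  generalize Real.sqrt (oscD ζ ω) = s at *
  subst hA hB hC'
  have hs0 := hs.ne'
  constructor
  · rintro ⟨h1, h2, h3, h4⟩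
    have hl : l = -σ * s / 2 := by
      field_simp at h1 ⊢
      linear_combination h1
    subst hl
    have hn : n = 0 := by
      have : s^2 * n = 0 := by
        rw [hsq]
        linear_combination (1 - ω^2) * h3 - 2*ζ*ω * h2
      simpa [hs0] using this
    subst hn
    have hm : m = -σ / s := by
      field_simp at h2 h3 ⊢
      have : s^2 * (m * s + σ) = 0 := by
        rw [hsq]
        linear_combination (1 - ω^2) * h2 + 2*ζ*ω * h3
      have := (mul_eq_zero.1 this).resolve_left (by positivity)
      linear_combination this
    subst hm
    refine ⟨rfl, rfl, rfl, ?_⟩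
    field_simp at h4 ⊢
    linear_combination h4
  · rintro ⟨rfl, rfl, rfl, rfl⟩
    refine ⟨?_, ?_, ?_, ?_⟩ <;> field_simp <;> ring

/-- under the steady-state constraints, Lagrange multipliers solving the
adjoint conditions exist iff `ω₁(1−2ζ²−ω₁²)/D(ζ,ω₁)^{3/2} = ω₂(1−2ζ²−ω₂²)/D(ζ,ω₂)^{3/2}`,
and in that case they are unique and given by the stated formulas. -/
theorem stmt6 (ζ ω₁ ω₂ ε A₁ B₁ C₁ A₂ B₂ C₂ : ℝ)
    (hζ : 0 < ζ) (hω₁ : 0 < ω₁) (hω₂ : 0 < ω₂) (hC₁ : 0 < C₁) (hC₂ : 0 < C₂)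
    (e1 : C₁^2 = A₁^2 + B₁^2) (e2 : C₂^2 = A₂^2 + B₂^2) (e3 : ω₁ - ω₂ = ε)
    (e4 : (1 - ω₁^2)*A₁ + 2*ζ*ω₁*B₁ = 1) (e5 : (1 - ω₁^2)*B₁ = 2*ζ*ω₁*A₁)
    (e6 : (1 - ω₂^2)*A₂ + 2*ζ*ω₂*B₂ = 1) (e7 : (1 - ω₂^2)*B₂ = 2*ζ*ω₂*A₂) :
    ((∃ l₁ l₂ l₃ l₄ l₅ l₆ l₇ : ℝ,
        adjointConds ζ ω₁ ω₂ A₁ B₁ C₁ A₂ B₂ C₂ l₁ l₂ l₃ l₄ l₅ l₆ l₇) ↔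
      ω₁*(1 - 2*ζ^2 - ω₁^2) / (oscD ζ ω₁) ^ ((3:ℝ)/2)
        = ω₂*(1 - 2*ζ^2 - ω₂^2) / (oscD ζ ω₂) ^ ((3:ℝ)/2)) ∧
    (∀ l₁ l₂ l₃ l₄ l₅ l₆ l₇ : ℝ,
      adjointConds ζ ω₁ ω₂ A₁ B₁ C₁ A₂ B₂ C₂ l₁ l₂ l₃ l₄ l₅ l₆ l₇ →
        l₁ = -Real.sqrt (oscD ζ ω₁) / 2 ∧
        l₂ = Real.sqrt (oscD ζ ω₂) / 2 ∧
        l₃ = -2*ω₁*(1 - 2*ζ^2 - ω₁^2) / (oscD ζ ω₁) ^ ((3:ℝ)/2) ∧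
        l₄ = -1 / Real.sqrt (oscD ζ ω₁) ∧
        l₅ = 0 ∧
        l₆ = 1 / Real.sqrt (oscD ζ ω₂) ∧
        l₇ = 0) := by
  have key : ∀ l₁ l₂ l₃ l₄ l₅ l₆ l₇ : ℝ,
      adjointConds ζ ω₁ ω₂ A₁ B₁ C₁ A₂ B₂ C₂ l₁ l₂ l₃ l₄ l₅ l₆ l₇ ↔
        (l₁ = -1 * Real.sqrt (oscD ζ ω₁) / 2 ∧ l₄ = -1 / Real.sqrt (oscD ζ ω₁) ∧ l₅ = 0 ∧
          l₃ = -2*1*(ω₁*(1 - 2*ζ^2 - ω₁^2) / (oscD ζ ω₁) ^ ((3:ℝ)/2))) ∧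
        (l₂ = -(-1) * Real.sqrt (oscD ζ ω₂) / 2 ∧ l₆ = -(-1) / Real.sqrt (oscD ζ ω₂) ∧ l₇ = 0 ∧
          -l₃ = -2*(-1)*(ω₂*(1 - 2*ζ^2 - ω₂^2) / (oscD ζ ω₂) ^ ((3:ℝ)/2))) := by
    intro l₁ l₂ l₃ l₄ l₅ l₆ l₇
    rw [← oscillator_adjoint_iff hζ hω₁ hC₁ e1 e4 e5, ← oscillator_adjoint_iff hζ hω₂ hC₂ e2 e6 e7]
    unfold adjointConds
    tauto
  simp only [key]
  refine ⟨⟨?_, fun h => ?_⟩, ?_⟩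
  · rintro ⟨l₁, l₂, l₃, l₄, l₅, l₆, l₇, ⟨-, -, -, h₁⟩, -, -, -, h₂⟩
    linear_combination (h₁ + h₂) / 2
  · refine ⟨_, _, _, _, _, _, _, ⟨rfl, rfl, rfl, rfl⟩, rfl, rfl, rfl, ?_⟩
    linear_combination 2 * h
  · rintro l₁ l₂ l₃ l₄ l₅ l₆ l₇ ⟨⟨rfl, rfl, rfl, rfl⟩, rfl, rfl, rfl, -⟩
    refine ⟨?_, ?_, ?_, rfl, rfl, ?_, rfl⟩ <;> ring
end

section
/- Let ζ, ω, A, B ∈ ℝ and let M be the 2×3 real matrix with rows (1−ω², 2ζω, 2ζB−2Aω) and (−2ζω, 1−ω², −2ζA−2Bω) (the Jacobian of the steady-state equations with respect to (A, B, ω)). Then the eigenvalues of M·Mᵀ are exactly D(ζ,ω) and D(ζ,ω) + 4(A²+B²)(ζ²+ω²); equivalently, the singular values of M are √D(ζ,ω) and √(D(ζ,ω) + 4(A²+B²)(ζ²+ω²)). -/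
/-- for the 2×3 Jacobian `M` of the steady-state equations with respect to
`(A, B, ω)`, the eigenvalues of `M·Mᵀ` are exactly `D(ζ,ω)` and
`D(ζ,ω) + 4(A²+B²)(ζ²+ω²)` (equivalently, the singular values of `M` are their
square roots). -/
theorem stmt10 (ζ ω A B : ℝ)
    (M : Matrix (Fin 2) (Fin 3) ℝ)
    (hM : M = !![1 - ω^2, 2*ζ*ω, 2*ζ*B - 2*A*ω;
                 -(2*ζ*ω), 1 - ω^2, -(2*ζ*A) - 2*B*ω]) :
    ∀ μ : ℝ,
      (M * M.transpose - μ • (1 : Matrix (Fin 2) (Fin 2) ℝ)).det = 0 ↔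
        (μ = oscD ζ ω ∨ μ = oscD ζ ω + 4*(A^2 + B^2)*(ζ^2 + ω^2)) := by
  intro μ
  have hdet : (M * M.transpose - μ • (1 : Matrix (Fin 2) (Fin 2) ℝ)).det =
      (μ - oscD ζ ω) * (μ - (oscD ζ ω + 4*(A^2 + B^2)*(ζ^2 + ω^2))) := by
    subst hM
    simp only [Matrix.det_fin_two, Matrix.sub_apply, Matrix.smul_apply, Matrix.mul_apply,
      Matrix.transpose_apply, Fin.sum_univ_three]
    simp [oscD]
    ring
  rw [hdet, mul_eq_zero, sub_eq_zero, sub_eq_zero]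
end

section
/- Let f : ℝⁿ → ℝⁿ and h : ℝⁿ → ℝ be continuously differentiable, T ∈ ℝ, and let x, λ : [0,1] → ℝⁿ be differentiable with x′(τ) = T·f(x(τ)) and λ′(τ) = −T·(Df(x(τ)))ᵀ·λ(τ) for all τ ∈ [0,1]. Suppose x(0) = x(1) (periodicity), and suppose λ_BC ∈ ℝⁿ and λ_PS ∈ ℝ satisfy the adjoint boundary conditions λ_BC − λ(0) + λ_PS·∇h(x(0)) = 0 and −λ_BC + λ(1) = 0. If the transversality condition ⟨∇h(x(0)), f(x(0))⟩ ≠ 0 holds, then λ_PS = 0 and λ(0) = λ(1), i.e. the adjoint variable is itself periodic. -/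
open scoped RealInnerProductSpace

/-- Along a solution of `x′ = T·f(x)`, the pairing of an adjoint solution with the vector field
has zero derivative. -/
theorem hasDerivAt_inner_adjoint_vectorField_zero {E : Type*} [NormedAddCommGroup E]
    [InnerProductSpace ℝ E] [CompleteSpace E] {f : E → E} {T τ : ℝ} {x lam : ℝ → E}
    (hf : DifferentiableAt ℝ f (x τ)) (hx : HasDerivAt x (T • f (x τ)) τ)
    (hlam : HasDerivAt lam
      ((-T) • (ContinuousLinearMap.adjoint (fderiv ℝ f (x τ))) (lam τ)) τ) :
    HasDerivAt (fun t => ⟪lam t, f (x t)⟫) 0 τ := by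
  have hfx : HasDerivAt (fun t => f (x t)) (fderiv ℝ f (x τ) (T • f (x τ))) τ :=
    hf.hasFDerivAt.comp_hasDerivAt τ hx
  refine (hlam.inner ℝ hfx).congr_deriv ?_
  rw [map_smul, real_inner_smul_left, real_inner_smul_right,
    ContinuousLinearMap.adjoint_inner_left]
  ring

/-- for the adjoint system of the periodic-orbit problem
`x′ = T·f(x)`, `x(0) = x(1)`, `h(x(0)) = 0`, with adjoint boundary conditions
`λ_BC − λ(0) + λ_PS·∇h(x(0)) = 0` and `−λ_BC + λ(1) = 0`, transversality
`⟨∇h(x(0)), f(x(0))⟩ ≠ 0` implies `λ_PS = 0` and `λ(0) = λ(1)`. -/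
theorem stmt15 {n : ℕ}
    (f : EuclideanSpace ℝ (Fin n) → EuclideanSpace ℝ (Fin n))
    (h : EuclideanSpace ℝ (Fin n) → ℝ)
    (hf : ContDiff ℝ 1 f) (hh : ContDiff ℝ 1 h) (T : ℝ)
    (x lam : ℝ → EuclideanSpace ℝ (Fin n))
    (hx : ∀ τ ∈ Set.Icc (0:ℝ) 1, HasDerivAt x (T • f (x τ)) τ)
    (hlam : ∀ τ ∈ Set.Icc (0:ℝ) 1,
      HasDerivAt lam
        ((-T) • (ContinuousLinearMap.adjoint (fderiv ℝ f (x τ))) (lam τ)) τ)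
    (hper : x 0 = x 1)
    (lamBC : EuclideanSpace ℝ (Fin n)) (lamPS : ℝ)
    (hBC0 : lamBC - lam 0 + lamPS • gradient h (x 0) = 0)
    (hBC1 : -lamBC + lam 1 = 0)
    (htrans : ⟪gradient h (x 0), f (x 0)⟫ ≠ 0) :
    lamPS = 0 ∧ lam 0 = lam 1 := by
  have hderiv : ∀ τ ∈ Set.Icc (0:ℝ) 1, HasDerivAt (fun t => ⟪lam t, f (x t)⟫) 0 τ :=
    fun τ hτ => hasDerivAt_inner_adjoint_vectorField_zero
      (hf.differentiable one_ne_zero (x τ)) (hx τ hτ) (hlam τ hτ)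
  have hconst : ⟪lam 1, f (x 1)⟫ = ⟪lam 0, f (x 0)⟫ :=
    constant_of_has_deriv_right_zero
      (fun τ hτ => (hderiv τ hτ).continuousAt.continuousWithinAt)
      (fun τ hτ => (hderiv τ (Set.Ico_subset_Icc_self hτ)).hasDerivWithinAt)
      1 (Set.right_mem_Icc.mpr zero_le_one)
  have hjump : lam 0 - lam 1 = lamPS • gradient h (x 0) := by
    linear_combination (norm := module) -hBC0 - hBC1
  have hPS : lamPS = 0 := by
    have hinner : lamPS * ⟪gradient h (x 0), f (x 0)⟫ = 0 := by
      rw [← real_inner_smul_left, ← hjump, inner_sub_left, ← hconst, hper, sub_self]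
    exact (mul_eq_zero.mp hinner).resolve_right htrans
  refine ⟨hPS, sub_eq_zero.mp ?_⟩
  rw [hjump, hPS, zero_smul]
end

section
/- Let f : ℝⁿ × ℝⁿ → ℝⁿ be continuously differentiable, T > 0, α ∈ (0, T). Let x : [0,1] → ℝⁿ be continuously differentiable with x(0) = x(1), define y : [0,1] → ℝⁿ by y(τ) = x(τ + 1 − α/T) for τ ∈ [0, α/T] and y(τ) = x(τ − α/T) for τ ∈ [α/T, 1] (well-defined and continuously differentiable by periodicity), and assume x′(τ) = T·f(x(τ), y(τ)) for all τ ∈ [0,1]. Let λ_DE : [0,1] → ℝⁿ be continuous and differentiable on (0, 1−α/T) ∪ (1−α/T, 1), and λ_CP : [0,1] → ℝⁿ continuous, with λ_DE′(τ) = −T·(D_x f(x(τ),y(τ)))ᵀλ_DE(τ) − λ_CP(τ+α/T) for τ ∈ (0, 1−α/T), λ_DE′(τ) = −T·(D_x f(x(τ),y(τ)))ᵀλ_DE(τ) − λ_CP(τ+α/T−1) for τ ∈ (1−α/T, 1), and λ_CP(τ) = T·(D_y f(x(τ),y(τ)))ᵀλ_DE(τ) for τ ∈ [0,1]. Then the function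 H : [0,1] → ℝ defined by H(t) := ⟨λ_DE(t), f(x(t),y(t))⟩ + (1/T)∫_t^{t+α/T} ⟨λ_CP(s), y′(s)⟩ ds for t ∈ [0, 1−α/T], and H(t) := ⟨λ_DE(t), f(x(t),y(t))⟩ + (1/T)∫_t^{1} ⟨λ_CP(s), y′(s)⟩ ds + (1/T)∫_0^{t−1+α/T} ⟨λ_CP(s), y′(s)⟩ ds for t ∈ [1−α/T, 1], is continuous and constant on [0,1]; in particular ⟨λ_DE(1), f(x(1),y(1))⟩ = ⟨λ_DE(0), f(x(0),y(0))⟩. -/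
open scoped RealInnerProductSpace

open Set

/-- Continuity on two adjacent closed intervals gives continuity on their union. -/
lemma continuousOn_Icc_of_adjacent {E : Type*} [TopologicalSpace E] {g : ℝ → E} {a b c : ℝ}
    (hab : a ≤ b) (hbc : b ≤ c) (h₁ : ContinuousOn g (Icc a b)) (h₂ : ContinuousOn g (Icc b c)) :
    ContinuousOn g (Icc a c) := by
  rw [← Icc_union_Icc_eq_Icc hab hbc]
  exact h₁.union_of_isClosed h₂ isClosed_Icc isClosed_Icc

/-- A continuous real function whose derivative vanishes off a countable set is constant. -/
lemma eq_left_of_hasDerivAt_zero_off_countable {G : ℝ → ℝ} {a b : ℝ} {s : Set ℝ}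
    (hs : s.Countable) (hc : ContinuousOn G (Icc a b))
    (hd : ∀ t ∈ Ioo a b \ s, HasDerivAt G 0 t) : ∀ t ∈ Icc a b, G t = G a := by
  intro t ht
  have h := MeasureTheory.integral_eq_of_hasDerivAt_off_countable_of_le G (fun _ => 0) ht.1 hs
    (hc.mono (Icc_subset_Icc_right ht.2))
    (fun u hu => hd u ⟨⟨hu.1.1, hu.1.2.trans_le ht.2⟩, hu.2⟩) (by simp)
  simp only [intervalIntegral.integral_zero] at h
  linarith

/-- The primitive of a continuous function over the window `[t, t + a]`, wrapped modulo `1`. -/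
noncomputable def wrappedWindow (a : ℝ) (K : ℝ → ℝ) (t : ℝ) : ℝ :=
  K (min (t + a) 1) + K (max (t - 1 + a) 0) - K t

lemma continuous_wrappedWindow {a : ℝ} {K : ℝ → ℝ} (hK : Continuous K) :
    Continuous (wrappedWindow a K) := by
  unfold wrappedWindow
  fun_prop

lemma hasDerivAt_wrappedWindow_of_lt {a t : ℝ} {K k : ℝ → ℝ} (hK : ∀ u, HasDerivAt K (k u) u)
    (ht : t < 1 - a) : HasDerivAt (wrappedWindow a K) (k (t + a) - k t) t := by
  have h := (((hK (t + a)).comp_add_const t a).add_const (K 0)).sub (hK t)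
  refine h.congr_of_eventuallyEq ?_
  filter_upwards [Iio_mem_nhds ht] with u hu
  have hu' : u < 1 - a := hu
  simp [wrappedWindow, min_eq_left (show u + a ≤ 1 by linarith),
    max_eq_right (show u - 1 + a ≤ 0 by linarith)]

lemma hasDerivAt_wrappedWindow_of_gt {a t : ℝ} {K k : ℝ → ℝ} (hK : ∀ u, HasDerivAt K (k u) u)
    (ht : 1 - a < t) : HasDerivAt (wrappedWindow a K) (k (t + a - 1) - k t) t := by
  have h := (((hK (t + (a - 1))).comp_add_const t (a - 1)).const_add (K 1)).sub (hK t)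
  rw [show t + a - 1 = t + (a - 1) by ring]
  refine h.congr_of_eventuallyEq ?_
  filter_upwards [Ioi_mem_nhds ht] with u hu
  have hu' : 1 - a < u := hu
  simp [wrappedWindow, min_eq_right (show 1 ≤ u + a by linarith),
    max_eq_left (show 0 ≤ u + (a - 1) by linarith), show u - 1 + a = u + (a - 1) by ring]

/-- Derivative of the pairing of an adjoint solution with the vector field along the orbit. -/
lemma hasDerivAt_inner_adjoint {E : Type*} [NormedAddCommGroup E] [InnerProductSpace ℝ E]
    [CompleteSpace E] {f : E × E → E} {T t : ℝ} {x y lam : ℝ → E} {v c p : E}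
    (hf : DifferentiableAt ℝ f (x t, y t)) (hT : T ≠ 0)
    (hx : HasDerivAt x (T • f (x t, y t)) t) (hy : HasDerivAt y v t)
    (hlam : HasDerivAt lam ((-T) • (ContinuousLinearMap.adjoint
      ((fderiv ℝ f (x t, y t)).comp (ContinuousLinearMap.inl ℝ E E))) (lam t) - c) t)
    (hp : p = T • (ContinuousLinearMap.adjoint
      ((fderiv ℝ f (x t, y t)).comp (ContinuousLinearMap.inr ℝ E E))) (lam t)) :
    HasDerivAt (fun u => ⟪lam u, f (x u, y u)⟫)
      ((1 / T) * (⟪p, v⟫ - ⟪c, T • f (x t, y t)⟫)) t := by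
  have hg : HasDerivAt (fun u => f (x u, y u)) (fderiv ℝ f (x t, y t) (T • f (x t, y t), v)) t :=
    hf.hasFDerivAt.comp_hasDerivAt t (hx.prodMk hy)
  have h := hlam.inner ℝ hg
  refine h.congr_deriv ?_
  have hsplit : ((T • f (x t, y t), v) : E × E) = T • (f (x t, y t), (0 : E)) + (0, v) := by simp
  rw [hp, hsplit, map_add, map_smul]
  simp only [inner_smul_left, inner_smul_right, inner_sub_left, inner_add_right,
    ContinuousLinearMap.adjoint_inner_left, ContinuousLinearMap.comp_apply,
    ContinuousLinearMap.inl_apply, ContinuousLinearMap.inr_apply, RCLike.conj_to_real]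
  field_simp
  ring

/-- for a periodic orbit of the delay differential equation
`ż(t) = f(z(t), z(t−α))` in rescaled form `x′ = T·f(x,y)` with wrapped delayed variable
`y`, and adjoint variables `λ_DE`, `λ_CP` satisfying the adjoint differential and
coupling conditions, the piecewise-defined function `H` is continuous and constant on
`[0,1]`; in particular `⟨λ_DE(1), f(x(1),y(1))⟩ = ⟨λ_DE(0), f(x(0),y(0))⟩`. -/
theorem stmt16 {n : ℕ}
    (f : EuclideanSpace ℝ (Fin n) × EuclideanSpace ℝ (Fin n) → EuclideanSpace ℝ (Fin n))
    (hf : ContDiff ℝ 1 f) (T α : ℝ) (hT : 0 < T) (hα0 : 0 < α) (hαT : α < T)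
    (x y x' : ℝ → EuclideanSpace ℝ (Fin n))
    (hper : x 0 = x 1)
    (hy1 : ∀ τ ∈ Set.Icc (0:ℝ) (α/T), y τ = x (τ + 1 - α/T))
    (hy2 : ∀ τ ∈ Set.Icc (α/T) (1:ℝ), y τ = x (τ - α/T))
    (hx : ∀ τ ∈ Set.Icc (0:ℝ) 1, HasDerivAt x (x' τ) τ)
    (hx'c : ContinuousOn x' (Set.Icc (0:ℝ) 1))
    (hODE : ∀ τ ∈ Set.Icc (0:ℝ) 1, x' τ = T • f (x τ, y τ))
    (lamDE lamCP : ℝ → EuclideanSpace ℝ (Fin n))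
    (hlamDEc : ContinuousOn lamDE (Set.Icc (0:ℝ) 1))
    (hlamCPc : ContinuousOn lamCP (Set.Icc (0:ℝ) 1))
    (hDE1 : ∀ τ ∈ Set.Ioo (0:ℝ) (1 - α/T),
      HasDerivAt lamDE
        ((-T) • (ContinuousLinearMap.adjoint
            ((fderiv ℝ f (x τ, y τ)).comp
              (ContinuousLinearMap.inl ℝ (EuclideanSpace ℝ (Fin n))
                (EuclideanSpace ℝ (Fin n))))) (lamDE τ)
          - lamCP (τ + α/T)) τ)
    (hDE2 : ∀ τ ∈ Set.Ioo (1 - α/T) (1:ℝ),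
      HasDerivAt lamDE
        ((-T) • (ContinuousLinearMap.adjoint
            ((fderiv ℝ f (x τ, y τ)).comp
              (ContinuousLinearMap.inl ℝ (EuclideanSpace ℝ (Fin n))
                (EuclideanSpace ℝ (Fin n))))) (lamDE τ)
          - lamCP (τ + α/T - 1)) τ)
    (hCP : ∀ τ ∈ Set.Icc (0:ℝ) 1,
      lamCP τ = T • (ContinuousLinearMap.adjoint
          ((fderiv ℝ f (x τ, y τ)).comp
            (ContinuousLinearMap.inr ℝ (EuclideanSpace ℝ (Fin n))
              (EuclideanSpace ℝ (Fin n))))) (lamDE τ))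
    (yd : ℝ → EuclideanSpace ℝ (Fin n))
    (hyd : ∀ s : ℝ, yd s = if s ≤ α/T then x' (s + 1 - α/T) else x' (s - α/T))
    (H : ℝ → ℝ)
    (hH : ∀ t : ℝ, H t =
      if t ≤ 1 - α/T then
        ⟪lamDE t, f (x t, y t)⟫ + (1/T) * ∫ s in t..(t + α/T), ⟪lamCP s, yd s⟫
      else
        ⟪lamDE t, f (x t, y t)⟫ + (1/T) * (∫ s in t..(1:ℝ), ⟪lamCP s, yd s⟫)
          + (1/T) * ∫ s in (0:ℝ)..(t - 1 + α/T), ⟪lamCP s, yd s⟫) :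
    ContinuousOn H (Set.Icc (0:ℝ) 1) ∧
    (∀ t ∈ Set.Icc (0:ℝ) 1, ∀ t' ∈ Set.Icc (0:ℝ) 1, H t = H t') ∧
    ⟪lamDE 1, f (x 1, y 1)⟫ = ⟪lamDE 0, f (x 0, y 0)⟫ := by
  obtain ⟨a, ha⟩ : ∃ a, a = α / T := ⟨_, rfl⟩
  rw [← ha] at hy1 hy2 hDE1 hDE2
  simp only [← ha] at hyd hH
  have ha0 : 0 < a := ha ▸ div_pos hα0 hT
  have ha1 : a < 1 := ha ▸ (div_lt_one hT).2 hαT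
  have hxc : ContinuousOn x (Icc 0 1) := fun τ hτ => (hx τ hτ).continuousAt.continuousWithinAt
  have hy01 : y 0 = y 1 := by
    rw [hy1 0 ⟨le_rfl, ha0.le⟩, hy2 1 ⟨ha1.le, le_rfl⟩, zero_add]
  have hx'01 : x' 0 = x' 1 := by
    rw [hODE 0 (by simp), hODE 1 (by simp), hper, hy01]
  have hyd_left : ∀ s ≤ a, yd s = x' (s + 1 - a) := fun s hs => by rw [hyd, if_pos hs]
  have hyd_right : ∀ s, a ≤ s → yd s = x' (s - a) := by
    intro s hs
    rcases hs.eq_or_lt with rfl | hs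
    · rw [hyd_left _ le_rfl, sub_self, hx'01, add_sub_cancel_left]
    · rw [hyd, if_neg hs.not_ge]
  have hmaps_left : MapsTo (fun s => s + 1 - a) (Icc 0 a) (Icc 0 1) :=
    fun s hs => ⟨by linarith [hs.1], by linarith [hs.2]⟩
  have hmaps_right : MapsTo (fun s => s - a) (Icc a 1) (Icc 0 1) :=
    fun s hs => ⟨by linarith [hs.1], by linarith [hs.2]⟩
  have hyc : ContinuousOn y (Icc 0 1) := continuousOn_Icc_of_adjacent ha0.le ha1.le
    ((hxc.comp (by fun_prop) hmaps_left).congr hy1)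
    ((hxc.comp (by fun_prop) hmaps_right).congr hy2)
  have hydc : ContinuousOn yd (Icc 0 1) := continuousOn_Icc_of_adjacent ha0.le ha1.le
    ((hx'c.comp (by fun_prop) hmaps_left).congr fun s hs => hyd_left s hs.2)
    ((hx'c.comp (by fun_prop) hmaps_right).congr fun s hs => hyd_right s hs.1)
  have hyderiv : ∀ t ∈ Ioo (0 : ℝ) 1 \ {a, 1 - a}, HasDerivAt y (yd t) t := by
    rintro t ⟨ht, hta⟩
    simp only [mem_insert_iff, mem_singleton_iff, not_or] at hta
    rcases lt_or_gt_of_ne hta.1 with h | h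
    · rw [hyd_left t h.le]
      have hd := hx _ (hmaps_left ⟨ht.1.le, h.le⟩)
      simp only [add_sub_assoc] at hd
      have hd' := hd.comp_add_const t (1 - a)
      rw [← add_sub_assoc] at hd'
      refine hd'.congr_of_eventuallyEq ?_
      filter_upwards [Ioo_mem_nhds ht.1 h] with u hu
      rw [hy1 u ⟨hu.1.le, hu.2.le⟩, add_sub_assoc]
    · rw [hyd_right t h.le]
      refine ((hx _ (hmaps_right ⟨h.le, ht.2.le⟩)).comp_sub_const t a).congr_of_eventuallyEq ?_
      filter_upwards [Ioo_mem_nhds h ht.2] with u hu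
      exact hy2 u ⟨hu.1.le, hu.2.le⟩
  have hφc : ContinuousOn (fun s => ⟪lamCP s, yd s⟫) (Icc 0 1) := hlamCPc.inner hydc
  obtain ⟨k, hk, hkφ⟩ : ∃ k : ℝ → ℝ, Continuous k ∧ ∀ s ∈ Icc (0 : ℝ) 1, k s = ⟪lamCP s, yd s⟫ :=
    ⟨IccExtend zero_le_one ((Icc (0 : ℝ) 1).domRestrict fun s => ⟪lamCP s, yd s⟫),
      hφc.domRestrict.Icc_extend', fun s hs => by rw [IccExtend_of_mem _ _ hs]; rfl⟩
  set K : ℝ → ℝ := fun t => ∫ s in (0 : ℝ)..t, k s with hKdef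
  have hK : ∀ u, HasDerivAt K (k u) u := fun u => hk.integral_hasStrictDerivAt 0 u |>.hasDerivAt
  have hKc : Continuous K := continuous_iff_continuousAt.2 fun u => (hK u).continuousAt
  have hint : ∀ u ∈ Icc (0 : ℝ) 1, ∀ v ∈ Icc (0 : ℝ) 1,
      ∫ s in u..v, ⟪lamCP s, yd s⟫ = K v - K u := by
    intro u hu v hv
    rw [hKdef, intervalIntegral.integral_interval_sub_left (hk.intervalIntegrable _ _)
      (hk.intervalIntegrable _ _)]
    exact intervalIntegral.integral_congr fun s hs => (hkφ s (uIcc_subset_Icc hu hv hs)).symm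
  have hK0 : K 0 = 0 := intervalIntegral.integral_same
  set G : ℝ → ℝ := fun t => ⟪lamDE t, f (x t, y t)⟫ + (1 / T) * wrappedWindow a K t with hG
  have hHG : ∀ t ∈ Icc (0 : ℝ) 1, H t = G t := by
    intro t ht
    rw [hH]
    split_ifs with h
    · rw [hint t ht (t + a) ⟨by linarith [ht.1], by linarith⟩]
      simp [hG, wrappedWindow, min_eq_left (show t + a ≤ 1 by linarith),
        max_eq_right (show t - 1 + a ≤ 0 by linarith), hK0]
    · rw [not_le] at h
      rw [hint t ht 1 (by simp), hint 0 (by simp) (t - 1 + a) ⟨by linarith, by linarith [ht.2]⟩]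
      simp only [hG, wrappedWindow, min_eq_right (show 1 ≤ t + a by linarith),
        max_eq_left (show 0 ≤ t - 1 + a by linarith), hK0]
      ring
  have hGc : ContinuousOn G (Icc 0 1) :=
    (hlamDEc.inner (hf.continuous.comp_continuousOn (hxc.prodMk hyc))).add
      (continuousOn_const.mul (continuous_wrappedWindow hKc).continuousOn)
  have hGd : ∀ t ∈ Ioo (0 : ℝ) 1 \ {a, 1 - a}, HasDerivAt G 0 t := by
    intro t ht
    have htI : t ∈ Icc (0 : ℝ) 1 := Ioo_subset_Icc_self ht.1
    have hne : t ≠ 1 - a := fun h => ht.2 (by simp [h])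
    have hxt := hODE t htI ▸ hx t htI
    have hft : DifferentiableAt ℝ f (x t, y t) := hf.differentiable one_ne_zero _
    rcases lt_or_gt_of_ne hne with h | h
    · have hd := (hasDerivAt_inner_adjoint hft hT.ne' hxt (hyderiv t ht)
        (hDE1 t ⟨ht.1.1, h⟩) (hCP t htI)).add
        ((hasDerivAt_wrappedWindow_of_lt hK h).const_mul (1 / T))
      refine hd.congr_deriv ?_
      rw [hkφ t htI, hkφ (t + a) ⟨by linarith [htI.1], by linarith⟩,
        hyd_right (t + a) (by linarith [htI.1]), add_sub_cancel_right, hODE t htI]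
      ring
    · have hd := (hasDerivAt_inner_adjoint hft hT.ne' hxt (hyderiv t ht)
        (hDE2 t ⟨h, ht.1.2⟩) (hCP t htI)).add
        ((hasDerivAt_wrappedWindow_of_gt hK h).const_mul (1 / T))
      refine hd.congr_deriv ?_
      rw [hkφ t htI, hkφ (t + a - 1) ⟨by linarith, by linarith [htI.2]⟩,
        hyd_left (t + a - 1) (by linarith [htI.2]), show t + a - 1 + 1 - a = t by ring,
        hODE t htI]
      ring
  have hconst := eq_left_of_hasDerivAt_zero_off_countable
    (Set.toFinite {a, 1 - a}).countable hGc hGd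
  refine ⟨hGc.congr hHG, fun t ht t' ht' => ?_, ?_⟩
  · rw [hHG t ht, hHG t' ht', hconst t ht, hconst t' ht']
  · have h := hconst 1 (by simp)
    simp only [hG, wrappedWindow, sub_self, zero_add, zero_sub,
      min_eq_right (show (1 : ℝ) ≤ 1 + a by linarith), max_eq_left ha0.le, min_eq_left ha1.le,
      max_eq_right (show -1 + a ≤ 0 by linarith), hK0] at h
    linarith
end

section
/- Let n, q ∈ ℕ, T > 0, 0 < α < T, T₀ ∈ ℝ, p ∈ ℝ^q, and let f : ℝ × ℝⁿ × ℝⁿ × ℝ^q → ℝⁿ be continuous and T-periodic in its first argument (f(t+T, u, v, p) = f(t, u, v, p) for all t, u, v). Suppose x : [0,1] → ℝⁿ is continuously differentiable and y : [0,1] → ℝⁿ satisfy: x′(τ) = T·f(T₀+Tτ, x(τ), y(τ), p) for all τ ∈ [0,1]; y(τ) = x(τ + 1 − α/T) for τ ∈ [0, α/T] and y(τ) = x(τ − α/T) for τ ∈ [α/T, 1]; and x(0) = x(1). Define z : ℝ → ℝⁿ by z(T₀ + T(τ + k)) = x(τ) for τ ∈ [0, 1) and k ∈ ℤ. Then z is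 T-periodic, continuously differentiable on ℝ, and satisfies the delay differential equation ż(t) = f(t, z(t), z(t−α), p) for all t ∈ ℝ. -/
/-- the single-segment delay-coupled boundary-value problem
(`x′(τ) = T·f(T₀+Tτ, x(τ), y(τ), p)` with wrapped coupling `y` and periodic boundary
condition `x(0) = x(1)`, `f` being `T`-periodic in its first argument) unwraps to a
`T`-periodic, continuously differentiable solution `z` of the delay differential
equation `ż(t) = f(t, z(t), z(t−α), p)` on all of ℝ. -/
theorem stmt18 {n q : ℕ} (T α T₀ : ℝ) (hT : 0 < T) (hα0 : 0 < α) (hαT : α < T)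
    (p : EuclideanSpace ℝ (Fin q))
    (f : ℝ × EuclideanSpace ℝ (Fin n) × EuclideanSpace ℝ (Fin n)
          × EuclideanSpace ℝ (Fin q) → EuclideanSpace ℝ (Fin n))
    (hfc : Continuous f)
    (hfper : ∀ (t : ℝ) (u v : EuclideanSpace ℝ (Fin n)),
      f (t + T, u, v, p) = f (t, u, v, p))
    (x y : ℝ → EuclideanSpace ℝ (Fin n))
    (hxC : ContDiffOn ℝ 1 x (Set.Icc (0:ℝ) 1))
    (hODE : ∀ τ ∈ Set.Icc (0:ℝ) 1,
      HasDerivWithinAt x (T • f (T₀ + T*τ, x τ, y τ, p)) (Set.Icc (0:ℝ) 1) τ)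
    (hy1 : ∀ τ ∈ Set.Icc (0:ℝ) (α/T), y τ = x (τ + 1 - α/T))
    (hy2 : ∀ τ ∈ Set.Icc (α/T) (1:ℝ), y τ = x (τ - α/T))
    (hbc : x 0 = x 1)
    (z : ℝ → EuclideanSpace ℝ (Fin n))
    (hz : ∀ τ ∈ Set.Ico (0:ℝ) 1, ∀ k : ℤ, z (T₀ + T*(τ + k)) = x τ) :
    Function.Periodic z T ∧
    ContDiff ℝ 1 z ∧
    ∀ t : ℝ, HasDerivAt z (f (t, z t, z (t - α), p)) t := by
  have hw : ∀ τ ∈ Set.Icc (0:ℝ) 1, ∀ k : ℤ, z (T₀ + T*(τ + k)) = x τ := by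
    intro τ hτ k
    rcases hτ.2.lt_or_eq with h | rfl
    · exact hz τ ⟨hτ.1, h⟩ k
    · rw [← hbc, ← hz 0 ⟨le_rfl, one_pos⟩ (k + 1)]
      push_cast
      ring_nf
  have hfint : ∀ (t : ℝ) (u v : EuclideanSpace ℝ (Fin n)) (k : ℤ),
      f (t + k * T, u, v, p) = f (t, u, v, p) := fun t u v k =>
    (Function.Periodic.int_mul (f := fun t => f (t, u, v, p)) (fun t => hfper t u v) k) t
  have hα1 : α / T < 1 := (div_lt_one hT).2 hαT
  have hα2 : 0 < α / T := div_pos hα0 hT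
  have hyw : ∀ τ ∈ Set.Icc (0:ℝ) 1, ∀ k : ℤ, y τ = z (T₀ + T*(τ + k) - α) := by
    intro τ hτ k
    have hTα : T * (α / T) = α := mul_div_cancel₀ α hT.ne'
    rcases le_total τ (α / T) with h | h
    · rw [hy1 τ ⟨hτ.1, h⟩, ← hw (τ + 1 - α / T) ⟨by linarith [hτ.1], by linarith⟩ (k - 1)]
      congr 1
      push_cast
      linear_combination -hTα
    · rw [hy2 τ ⟨h, hτ.2⟩, ← hw (τ - α / T) ⟨by linarith, by linarith [hτ.2]⟩ k]
      congr 1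
      linear_combination -hTα
  -- The rescaled function solves the equation on every closed unit cell.
  have hcell : ∀ (s : ℝ) (k : ℤ), s ∈ Set.Icc (k : ℝ) (k + 1) →
      HasDerivWithinAt (fun r : ℝ => z (T₀ + T * r))
        (T • f (T₀ + T * s, z (T₀ + T * s), z (T₀ + T * s - α), p))
        (Set.Icc (k : ℝ) (k + 1)) s := by
    intro s k hs
    have hτ : s - k ∈ Set.Icc (0:ℝ) 1 := ⟨by linarith [hs.1], by linarith [hs.2]⟩
    have hmaps : Set.MapsTo (fun r : ℝ => r - k) (Set.Icc (k : ℝ) (k + 1)) (Set.Icc 0 1) :=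
      fun r hr => ⟨by linarith [hr.1], by linarith [hr.2]⟩
    have hzx : ∀ r ∈ Set.Icc (k : ℝ) (k + 1), z (T₀ + T * r) = x (r - k) := fun r hr => by
      rw [← hw (r - k) (hmaps hr) k, sub_add_cancel]
    have hd := (hODE (s - k) hτ).scomp s ((hasDerivWithinAt_id s _).sub_const (k : ℝ)) hmaps
    have hF : f (T₀ + T * (s - k), x (s - k), y (s - k), p) =
        f (T₀ + T * s, z (T₀ + T * s), z (T₀ + T * s - α), p) := by
      rw [hyw (s - k) hτ k, sub_add_cancel, hzx s hs, ← hfint _ _ _ k]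
      congr 2
      ring
    rw [one_smul, hF] at hd
    exact hd.congr hzx (hzx s hs)
  have hline : ∀ s : ℝ, HasDerivAt (fun r : ℝ => z (T₀ + T * r))
      (T • f (T₀ + T * s, z (T₀ + T * s), z (T₀ + T * s - α), p)) s := by
    intro s
    have hR := (hcell s ⌊s⌋ ⟨Int.floor_le s, (Int.lt_floor_add_one s).le⟩).mono_of_mem_nhdsWithin
      (Icc_mem_nhdsGE_of_mem ⟨Int.floor_le s, Int.lt_floor_add_one s⟩)
    have hc1 : ((⌈s⌉ - 1 : ℤ) : ℝ) < s := by push_cast; linarith [Int.ceil_lt_add_one s]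
    have hc2 : s ≤ ((⌈s⌉ - 1 : ℤ) : ℝ) + 1 := by push_cast; linarith [Int.le_ceil s]
    have hL := (hcell s (⌈s⌉ - 1) ⟨hc1.le, hc2⟩).mono_of_mem_nhdsWithin
      (Icc_mem_nhdsLE_of_mem ⟨hc1, hc2⟩)
    simpa only [Set.Iic_union_Ici, hasDerivWithinAt_univ] using hL.union hR
  have hcoord : ∀ t : ℝ, T₀ + T * ((t - T₀) / T) = t := fun t => by
    rw [mul_div_cancel₀ _ hT.ne', add_sub_cancel]
  have hDDE : ∀ t : ℝ, HasDerivAt z (f (t, z t, z (t - α), p)) t := by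
    intro t
    have h := (hline ((t - T₀) / T)).scomp t (((hasDerivAt_id t).sub_const T₀).div_const T)
    simp only [hcoord, smul_smul, one_div, inv_mul_cancel₀ hT.ne', one_smul] at h
    exact h.congr_of_eventuallyEq (Filter.Eventually.of_forall fun r => by simp [hcoord])
  refine ⟨fun t => ?_, ?_, hDDE⟩
  · set s := (t - T₀) / T with hs
    have hfr : Int.fract s ∈ Set.Ico (0:ℝ) 1 := ⟨Int.fract_nonneg s, Int.fract_lt_one s⟩
    have h0 := hz _ hfr ⌊s⌋
    have h1 := hz _ hfr (⌊s⌋ + 1)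
    rw [Int.fract_add_floor, hcoord] at h0
    rw [Int.cast_add, ← add_assoc, Int.fract_add_floor, Int.cast_one, mul_add, mul_one,
      ← add_assoc, hcoord] at h1
    rw [h0, h1]
  · have hzc : Continuous z := continuous_iff_continuousAt.2 fun t => (hDDE t).continuousAt
    refine contDiff_one_iff_deriv.2 ⟨fun t => (hDDE t).differentiableAt, ?_⟩
    rw [funext fun t => (hDDE t).deriv]
    fun_prop
end

section
/- Let Ω > 0, T := 2π/Ω, and ω, φ ∈ ℝ. Define r̂(t) := (1+Ω²)/(1+Ω² − cos(Ωt) − Ω·sin(Ωt)) for t ∈ ℝ; then the denominator is strictly positive for all t, and the curve z(t) := (r̂(t)·cos(ωt+φ), r̂(t)·sin(ωt+φ)) satisfies |z(t)| = r̂(t) and is a solution of the system ż₁(t) = −ω·z₂(t) + z₁(t)·(1 + |z(t)|·(cos(2πt/T) − 1)), ż₂(t) = ω·z₁(t) + z₂(t)·(1 + |z(t)|·(cos(2πt/T) − 1)) for all t ∈ ℝ, where |z| denotes the Euclidean norm. In particular, for each Ω and ω this yields a family, parameterized by the phase φ ∈ ℝ, of solutions lying on an invariant torus; when ωT/(2π)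 is irrational these solutions are quasiperiodic with angular frequencies 2π/T and ω. -/
theorem one_add_sq_sub_cos_sub_mul_sin_pos {Ω : ℝ} (hΩ : 0 < Ω) (t : ℝ) :
    0 < 1 + Ω^2 - Real.cos (Ω*t) - Ω*Real.sin (Ω*t) := by
  have hsq : (Real.cos (Ω*t) + Ω*Real.sin (Ω*t))^2 ≤ 1 + Ω^2 := by
    have h : (Real.cos (Ω*t) + Ω*Real.sin (Ω*t))^2
        + (Real.sin (Ω*t) - Ω*Real.cos (Ω*t))^2 = 1 + Ω^2 := by
      linear_combination (1 + Ω^2) * Real.sin_sq_add_cos_sq (Ω*t)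
    linarith [sq_nonneg (Real.sin (Ω*t) - Ω*Real.cos (Ω*t))]
  have hΩ2 : 0 < Ω^2 := by positivity
  by_contra! h
  nlinarith

/-- The radius function solves the Bernoulli equation `r' = r (1 + r (cos (Ω t) - 1))`. -/
theorem hasDerivAt_radius {Ω : ℝ} (hΩ : 0 < Ω) (t : ℝ) :
    HasDerivAt
      (fun x : ℝ => (1 + Ω^2) / (1 + Ω^2 - Real.cos (Ω*x) - Ω*Real.sin (Ω*x)))
      ((1 + Ω^2) / (1 + Ω^2 - Real.cos (Ω*t) - Ω*Real.sin (Ω*t))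
        * (1 + (1 + Ω^2) / (1 + Ω^2 - Real.cos (Ω*t) - Ω*Real.sin (Ω*t))
          * (Real.cos (Ω*t) - 1))) t := by
  have hD := (one_add_sq_sub_cos_sub_mul_sin_pos hΩ t).ne'
  have hlin : HasDerivAt (fun x : ℝ => Ω*x) Ω t := by
    simpa using (hasDerivAt_id t).const_mul Ω
  refine ((hasDerivAt_const t (1 + Ω^2)).div
    ((hlin.cos.const_sub (1 + Ω^2)).sub (hlin.sin.const_mul Ω)) hD).congr_deriv ?_
  simp only [Pi.sub_apply]
  field_simp
  ring


/-- for `Ω > 0`, `T := 2π/Ω`, and any `ω, φ ∈ ℝ`, with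
`r̂(t) = (1+Ω²)/(1+Ω² − cos(Ωt) − Ω sin(Ωt))` (denominator strictly positive), the curve
`z(t) = (r̂(t)cos(ωt+φ), r̂(t)sin(ωt+φ))` has Euclidean norm `|z(t)| = r̂(t)` and solves
`ż₁ = −ωz₂ + z₁(1 + |z|(cos(2πt/T) − 1))`, `ż₂ = ωz₁ + z₂(1 + |z|(cos(2πt/T) − 1))`
for all `t` — a family of solutions on an invariant torus parameterized by the phase
`φ`. -/
theorem stmt19 (Ω ω φ : ℝ) (hΩ : 0 < Ω) (T : ℝ) (hT : T = 2*Real.pi/Ω)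
    (rhat z₁ z₂ : ℝ → ℝ)
    (hr : ∀ t : ℝ, rhat t
      = (1 + Ω^2) / (1 + Ω^2 - Real.cos (Ω*t) - Ω*Real.sin (Ω*t)))
    (hz₁ : ∀ t : ℝ, z₁ t = rhat t * Real.cos (ω*t + φ))
    (hz₂ : ∀ t : ℝ, z₂ t = rhat t * Real.sin (ω*t + φ)) :
    (∀ t : ℝ, 0 < 1 + Ω^2 - Real.cos (Ω*t) - Ω*Real.sin (Ω*t)) ∧
    (∀ t : ℝ, Real.sqrt (z₁ t^2 + z₂ t^2) = rhat t) ∧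
    (∀ t : ℝ,
      HasDerivAt z₁
        (-ω * z₂ t + z₁ t * (1 + Real.sqrt (z₁ t^2 + z₂ t^2)
          * (Real.cos (2*Real.pi*t/T) - 1))) t ∧
      HasDerivAt z₂
        (ω * z₁ t + z₂ t * (1 + Real.sqrt (z₁ t^2 + z₂ t^2)
          * (Real.cos (2*Real.pi*t/T) - 1))) t) := by
  have hD : ∀ t : ℝ, 0 < 1 + Ω^2 - Real.cos (Ω*t) - Ω*Real.sin (Ω*t) :=
    one_add_sq_sub_cos_sub_mul_sin_pos hΩ
  have hnorm : ∀ t : ℝ, Real.sqrt (z₁ t^2 + z₂ t^2) = rhat t := by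
    intro t
    have hr_nonneg : 0 ≤ rhat t := by
      rw [hr]
      exact div_nonneg (by positivity) (hD t).le
    have hsq : z₁ t^2 + z₂ t^2 = rhat t^2 := by
      rw [hz₁, hz₂]
      linear_combination rhat t^2 * Real.sin_sq_add_cos_sq (ω*t + φ)
    rw [hsq, Real.sqrt_sq hr_nonneg]
  refine ⟨hD, hnorm, fun t => ?_⟩
  have hT' : 2*Real.pi*t/T = Ω*t := by
    rw [hT]
    field_simp
  have hr' : HasDerivAt rhat (rhat t * (1 + rhat t * (Real.cos (Ω*t) - 1))) t := by
    rw [funext hr]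
    exact hasDerivAt_radius hΩ t
  have hθ : HasDerivAt (fun x : ℝ => ω*x + φ) ω t := by
    simpa using ((hasDerivAt_id t).const_mul ω).add_const φ
  rw [hnorm, hT', funext hz₁, funext hz₂]
  constructor
  · refine (hr'.mul hθ.cos).congr_deriv ?_
    ring
  · refine (hr'.mul hθ.sin).congr_deriv ?_
    ring
end
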